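/- arXiv:1603.05355 — 7 statements merged into one kernel-verified Lean document; each statement's English description precedes it below -/
import Mathlib

section
/- (Lemma 1, RMBR recurrence.) Suppose loc '' RFS w is bounded above and bounded below in ℝ × ℝ for every vertex w. Let v be a vertex with RFS v nonempty. Then the reachability minimum bounding rectangle of v equals the minimum bounding rectangle of the union, over all out-edge neighbors v' of v, of the spatial locations of spatial neighbors together with the neighbors' RMBRs: MBR (loc '' RFS v) = MBR (⋃_{v' ∈ out v} (loc '' ({v'} ∩ S) ∪ ⋃ (_ : (RFS v').Nonempty), MBR (loc '' RFS v'))). -/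
/-- The reachable spatial set of `v`: spatial vertices reachable from `v`
via at least one edge. -/
def RFS {V : Type*} (E : V → V → Prop) (S : Set V) (v : V) : Set V :=
  {u | u ∈ S ∧ Relation.TransGen E v u}

/-- The out-edge neighbors of `v`. -/
def out {V : Type*} (E : V → V → Prop) (v : V) : Set V := {v' | E v v'}

/-- The minimum bounding rectangle of a set of points in the plane
(with the coordinatewise order). -/
noncomputable def MBR (T : Set (ℝ × ℝ)) : Set (ℝ × ℝ) := Set.Icc (sInf T) (sSup T)

theorem isLUB_sSup_real_prod {T : Set (ℝ × ℝ)} (hne : T.Nonempty) (h : BddAbove T) :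
    IsLUB T (sSup T) :=
  isLUB_prod.2 ⟨isLUB_csSup (hne.image _) (monotone_fst.map_bddAbove h),
    isLUB_csSup (hne.image _) (monotone_snd.map_bddAbove h)⟩

theorem isGLB_sInf_real_prod {T : Set (ℝ × ℝ)} (hne : T.Nonempty) (h : BddBelow T) :
    IsGLB T (sInf T) :=
  isGLB_prod.2 ⟨isGLB_csInf (hne.image _) (monotone_fst.map_bddBelow h),
    isGLB_csInf (hne.image _) (monotone_snd.map_bddBelow h)⟩

theorem subset_MBR {T : Set (ℝ × ℝ)} (ha : BddAbove T) (hb : BddBelow T) : T ⊆ MBR T :=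
  fun _ hx => ⟨(isGLB_sInf_real_prod ⟨_, hx⟩ hb).1 hx, (isLUB_sSup_real_prod ⟨_, hx⟩ ha).1 hx⟩

theorem MBR_mono {T U : Set (ℝ × ℝ)} (hne : T.Nonempty) (ha : BddAbove U) (hb : BddBelow U)
    (h : T ⊆ U) : MBR T ⊆ MBR U :=
  Set.Icc_subset_Icc
    ((isGLB_sInf_real_prod hne (hb.mono h)).mono (isGLB_sInf_real_prod (hne.mono h) hb) h)
    ((isLUB_sSup_real_prod hne (ha.mono h)).mono (isLUB_sSup_real_prod (hne.mono h) ha) h)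

theorem MBR_eq_of_subset_of_subset_MBR {T U : Set (ℝ × ℝ)} (hne : T.Nonempty) (ha : BddAbove T)
    (hb : BddBelow T) (h : T ⊆ U) (h' : U ⊆ MBR T) : MBR T = MBR U := by
  have hT := isLUB_sSup_real_prod hne ha
  have hT' := isGLB_sInf_real_prod hne hb
  have hU : IsLUB U (sSup T) :=
    ⟨fun _ hx => (h' hx).2, fun _ hy => hT.2 fun _ hx => hy (h hx)⟩
  have hU' : IsGLB U (sInf T) :=
    ⟨fun _ hx => (h' hx).1, fun _ hy => hT'.2 fun _ hx => hy (h hx)⟩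
  unfold MBR
  rw [hU.unique (isLUB_sSup_real_prod (hne.mono h) ⟨_, hU.1⟩),
    hU'.unique (isGLB_sInf_real_prod (hne.mono h) ⟨_, hU'.1⟩)]

theorem RFS_subset_of_edge {V : Type*} {E : V → V → Prop} (S : Set V) {v v' : V} (h : E v v') :
    RFS E S v' ⊆ RFS E S v :=
  fun _ hu => ⟨hu.1, .head h hu.2⟩

/-- Lemma 1 (RMBR recurrence): the RMBR of `v` equals the MBR of the union,
over all out-edge neighbors `v'` of `v`, of the locations of spatial neighbors
together with the neighbors' RMBRs. -/
theorem RMBR_recurrence {V : Type*} (E : V → V → Prop) (S : Set V) (loc : V → ℝ × ℝ)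
    (hbddAbove : ∀ w, BddAbove (loc '' RFS E S w))
    (hbddBelow : ∀ w, BddBelow (loc '' RFS E S w))
    (v : V) (hne : (RFS E S v).Nonempty) :
    MBR (loc '' RFS E S v) =
      MBR (⋃ v' ∈ out E v,
        (loc '' ({v'} ∩ S) ∪
          ⋃ (_ : (RFS E S v').Nonempty), MBR (loc '' RFS E S v'))) := by
  refine MBR_eq_of_subset_of_subset_MBR (hne.image _) (hbddAbove v) (hbddBelow v) ?_ ?_
  · rintro _ ⟨u, ⟨huS, hvu⟩, rfl⟩
    obtain ⟨v', hE, hv'u⟩ := Relation.TransGen.head'_iff.1 hvu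
    refine Set.mem_iUnion₂.2 ⟨v', hE, ?_⟩
    obtain rfl | hv'u := Relation.reflTransGen_iff_eq_or_transGen.1 hv'u
    · exact .inl ⟨u, ⟨rfl, huS⟩, rfl⟩
    · have hu : u ∈ RFS E S v' := ⟨huS, hv'u⟩
      exact .inr (Set.mem_iUnion.2 ⟨⟨u, hu⟩,
        subset_MBR (hbddAbove v') (hbddBelow v') (Set.mem_image_of_mem loc hu)⟩)
  · refine Set.iUnion₂_subset fun v' hE => Set.union_subset ?_ (Set.iUnion_subset fun hne' => ?_)
    · rintro _ ⟨u, ⟨rfl, huS⟩, rfl⟩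
      exact subset_MBR (hbddAbove v) (hbddBelow v) ⟨u, ⟨huS, .single hE⟩, rfl⟩
    · exact MBR_mono (hne'.image _) (hbddAbove v) (hbddBelow v)
        (Set.image_mono (RFS_subset_of_edge S hE))
end

section
/- (MBR idempotence under union, the key step in Lemma 1.) Let A, B ⊆ ℝ × ℝ with A nonempty, bounded above and bounded below, and with A ∪ B bounded above and bounded below. Then MBR (A ∪ B) = MBR (MBR A ∪ B); that is, replacing A by its minimum bounding rectangle does not change the minimum bounding rectangle of the union. -/
/-- In the plane, `sSup` is the least upper bound of a nonempty set that is bounded above. -/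
theorem isLUB_sSup_prod {T : Set (ℝ × ℝ)} (hT : T.Nonempty) (hb : BddAbove T) :
    IsLUB T (sSup T) :=
  isLUB_prod.2 ⟨isLUB_csSup (hT.image _) (monotone_fst.map_bddAbove hb),
    isLUB_csSup (hT.image _) (monotone_snd.map_bddAbove hb)⟩

/-- In the plane, `sInf` is the greatest lower bound of a nonempty set that is bounded below. -/
theorem isGLB_sInf_prod {T : Set (ℝ × ℝ)} (hT : T.Nonempty) (hb : BddBelow T) :
    IsGLB T (sInf T) :=
  isGLB_prod.2 ⟨isGLB_csInf (hT.image _) (monotone_fst.map_bddBelow hb),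
    isGLB_csInf (hT.image _) (monotone_snd.map_bddBelow hb)⟩

/-- MBR idempotence under union: replacing `A` by its minimum bounding rectangle
does not change the minimum bounding rectangle of the union. -/
theorem MBR_union_MBR (A B : Set (ℝ × ℝ))
    (hA : A.Nonempty) (hAa : BddAbove A) (hAb : BddBelow A)
    (hABa : BddAbove (A ∪ B)) (hABb : BddBelow (A ∪ B)) :
    MBR (A ∪ B) = MBR (MBR A ∪ B) := by
  have hsup := isLUB_sSup_prod hA hAa
  have hinf := isGLB_sInf_prod hA hAb
  have hle : sInf A ≤ sSup A := isGLB_le_isLUB hinf hsup hA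
  have hne : (MBR A ∪ B).Nonempty := ⟨sInf A, Or.inl ⟨le_rfl, hle⟩⟩
  have hub : upperBounds (MBR A ∪ B) = upperBounds (A ∪ B) := by
    rw [upperBounds_union, upperBounds_union, MBR, upperBounds_Icc hle, hsup.upperBounds_eq]
  have hlb : lowerBounds (MBR A ∪ B) = lowerBounds (A ∪ B) := by
    rw [lowerBounds_union, lowerBounds_union, MBR, lowerBounds_Icc hle, hinf.lowerBounds_eq]
  have hS := isLUB_sSup_prod hne (by rwa [BddAbove, hub])
  have hI := isGLB_sInf_prod hne (by rwa [BddBelow, hlb])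
  rw [IsLUB, hub] at hS
  rw [IsGLB, hlb] at hI
  rw [MBR, MBR, (isLUB_sSup_prod hA.inl hABa).unique hS, (isGLB_sInf_prod hA.inl hABb).unique hI]
end

section
/- (Closed form for reachability after adding a single edge.) Let E : V → V → Prop be a directed edge relation, a b : V, and let E' be the relation with the edge (a, b) added: E' p q ↔ E p q ∨ (p = a ∧ q = b). Then for all vertices u, x: Relation.TransGen E' u x ↔ Relation.TransGen E u x ∨ (Relation.ReflTransGen E u a ∧ Relation.ReflTransGen E b x). -/
/-- Closed form for reachability after adding the single edge `(a, b)`. -/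
theorem transGen_addEdge_iff {V : Type*} (E : V → V → Prop) (a b u x : V) :
    Relation.TransGen (fun p q => E p q ∨ (p = a ∧ q = b)) u x ↔
      Relation.TransGen E u x ∨
        (Relation.ReflTransGen E u a ∧ Relation.ReflTransGen E b x) := by
  constructor
  · intro h
    induction h with
    | single h =>
      rcases h with h | ⟨rfl, rfl⟩
      · exact .inl (.single h)
      · exact .inr ⟨.refl, .refl⟩
    | tail _ h ih =>
      rcases h with h | ⟨rfl, rfl⟩
      · exact ih.imp (fun k => k.tail h) (fun k => ⟨k.1, k.2.tail h⟩)
      · exact .inr ⟨ih.elim (fun k => k.to_reflTransGen) (fun k => k.1), .refl⟩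
  · have hE : ∀ p q, E p q → E p q ∨ (p = a ∧ q = b) := fun _ _ => Or.inl
    rintro (h | ⟨hua, hbx⟩)
    · exact Relation.TransGen.mono hE _ _ h
    · exact (Relation.TransGen.tail' (Relation.ReflTransGen.mono hE _ _ hua)
        (Or.inr ⟨rfl, rfl⟩)).trans_left (Relation.ReflTransGen.mono hE _ _ hbx)
end

section
/- (Update rule for the from-side vertex under edge addition.) Let E' be E with the edge (a, b) added: E' p q ↔ E p q ∨ (p = a ∧ q = b). Then the reachable spatial set of a in the new graph equals its old reachable spatial set, united with b if b is spatial, united with the old reachable spatial set of b: {x ∈ S | Relation.TransGen E' a x} = {x ∈ S | Relation.TransGen E a x} ∪ ({b} ∩ S) ∪ {x ∈ S | Relation.TransGen E b x}. -/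
/-- Update rule for the from-side vertex under addition of the edge `(a, b)`:
the new reachable spatial set of `a` is its old one, united with `b` if `b` is
spatial, united with the old reachable spatial set of `b`. -/
theorem RFS_from_side_addEdge {V : Type*} (E : V → V → Prop) (S : Set V) (a b : V) :
    {x | x ∈ S ∧ Relation.TransGen (fun p q => E p q ∨ (p = a ∧ q = b)) a x} =
      {x | x ∈ S ∧ Relation.TransGen E a x} ∪ ({b} ∩ S) ∪
        {x | x ∈ S ∧ Relation.TransGen E b x} := by
  ext x
  simp only [Set.mem_union, Set.mem_inter_iff, Set.mem_ofPred_eq, Set.mem_singleton_iff]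
  constructor
  · rintro ⟨hx, h⟩
    have key : Relation.TransGen E a x ∨ x = b ∨ Relation.TransGen E b x := by
      clear hx
      induction h with
      | single h =>
        rcases h with h | ⟨-, rfl⟩
        · exact .inl (.single h)
        · exact .inr (.inl rfl)
      | tail _ h ih =>
        rcases h with h | ⟨-, rfl⟩
        · rcases ih with ih | rfl | ih
          · exact .inl (ih.tail h)
          · exact .inr (.inr (.single h))
          · exact .inr (.inr (ih.tail h))
        · exact .inr (.inl rfl)
    tauto
  · have lift {u : V} (h : Relation.TransGen E u x) :
        Relation.TransGen (fun p q => E p q ∨ (p = a ∧ q = b)) u x :=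
      Relation.TransGen.mono (fun _ _ => Or.inl) _ _ h
    rintro ((⟨hx, h⟩ | ⟨rfl, hx⟩) | ⟨hx, h⟩)
    · exact ⟨hx, lift h⟩
    · exact ⟨hx, .single (.inr ⟨rfl, rfl⟩)⟩
    · exact ⟨hx, .head (.inr ⟨rfl, rfl⟩) (lift h)⟩
end

section
/- (The to-side vertex is unaffected by deleting an edge.) Let E'' be E with the edge (a, b) removed: E'' p q ↔ E p q ∧ ¬(p = a ∧ q = b). Then for every vertex x with x ≠ b: Relation.TransGen E b x ↔ Relation.TransGen E'' b x. In particular, the set of spatial vertices other than b reachable from b is unchanged by deleting the edge (a, b). -/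
/-- Reachability from `b` by a possibly empty path survives the removal of an edge into `b`. -/
theorem reflTransGen_deleteEdge_of_reflTransGen {V : Type*} {E : V → V → Prop} (a : V) {b x : V}
    (h : Relation.ReflTransGen E b x) :
    Relation.ReflTransGen (fun p q => E p q ∧ ¬(p = a ∧ q = b)) b x := by
  induction h with
  | refl => exact .refl
  | @tail y z _ hyz ih =>
    by_cases hz : z = b
    · rw [hz]
    · exact ih.tail ⟨hyz, fun h => hz h.2⟩

/-- The to-side vertex is unaffected by deleting the edge `(a, b)`: for every
vertex `x ≠ b`, reachability from `b` is unchanged. -/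
theorem transGen_from_toSide_deleteEdge {V : Type*} (E : V → V → Prop) (a b : V)
    (x : V) (hx : x ≠ b) :
    Relation.TransGen E b x ↔
      Relation.TransGen (fun p q => E p q ∧ ¬(p = a ∧ q = b)) b x := by
  refine ⟨fun h => ?_, fun h => h.mono (fun _ _ hpq => hpq.1) b x⟩
  exact (Relation.reflTransGen_iff_eq_or_transGen.mp
    (reflTransGen_deleteEdge_of_reflTransGen a h.to_reflTransGen)).resolve_left hx
end

section
/- (Area of the overlap-position region, used for P_NoOverlap.) Let A, B, e, f, x₁, x₂, y₁, y₂ ∈ ℝ with 0 ≤ x₁ ≤ x₂ ≤ A, 0 ≤ y₁ ≤ y₂ ≤ B, 0 ≤ e ≤ A and 0 ≤ f ≤ B. Let I = Set.Icc (0, 0) (A - e, B - f) be the set of admissible lower-left corner positions. Then the Lebesgue measure of the set of positions u ∈ I for which the query rectangle Set.Icc u (u + (e, f)) intersects the RMBR Set.Icc (x₁, y₁) (x₂, y₂) equals ENNReal.ofReal ((min (A - e) x₂ - max 0 (x₁ - e)) * (min (B - f) y₂ - max 0 (y₁ - f))). Consequently, the measure of the no-overlap positions equals the measure of I minus this quantity.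 -/
open MeasureTheory

/-- In a lattice, two nonempty closed intervals meet iff each lower end lies below the
other's upper end. -/
theorem Icc_inter_Icc_nonempty_iff {α : Type*} [Lattice α] {a b c d : α}
    (hab : a ≤ b) (hcd : c ≤ d) :
    (Set.Icc a b ∩ Set.Icc c d).Nonempty ↔ a ≤ d ∧ c ≤ b := by
  simp [Set.Icc_inter_Icc, Set.nonempty_Icc, hab, hcd, and_comm]

/-- The admissible positions at which the query rectangle meets a fixed rectangle form a
closed rectangle. -/
theorem overlap_positions_eq_Icc {A B e f x₁ x₂ y₁ y₂ : ℝ}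
    (hx : x₁ ≤ x₂) (hy : y₁ ≤ y₂) (he0 : 0 ≤ e) (hf0 : 0 ≤ f) :
    {u : ℝ × ℝ | u ∈ Set.Icc ((0 : ℝ), (0 : ℝ)) (A - e, B - f) ∧
        (Set.Icc u (u + (e, f)) ∩ Set.Icc ((x₁ : ℝ), y₁) (x₂, y₂)).Nonempty} =
      Set.Icc (max 0 (x₁ - e), max 0 (y₁ - f)) (min (A - e) x₂, min (B - f) y₂) := by
  ext ⟨a, b⟩
  have hu : (a, b) ≤ (a, b) + (e, f) := le_add_of_nonneg_right ⟨he0, hf0⟩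
  have hr : (x₁, y₁) ≤ (x₂, y₂) := ⟨hx, hy⟩
  rw [Set.mem_ofPred_eq, Icc_inter_Icc_nonempty_iff hu hr]
  simp only [Set.mem_Icc, Prod.mk_add_mk, Prod.mk_le_mk, max_le_iff, le_min_iff,
    sub_le_iff_le_add]
  tauto

theorem volume_Icc_real_prod {a b c d : ℝ} (hac : a ≤ c) :
    volume (Set.Icc (a, b) (c, d)) = ENNReal.ofReal ((c - a) * (d - b)) := by
  rw [← Set.Icc_prod_Icc, Measure.volume_eq_prod, Measure.prod_prod, Real.volume_Icc,
    Real.volume_Icc, ENNReal.ofReal_mul (sub_nonneg.2 hac)]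

/-- Area of the overlap-position region (used for `P_NoOverlap`): the Lebesgue
measure of the set of admissible lower-left corner positions at which the query
rectangle intersects the RMBR, together with the consequence for the measure of
the no-overlap positions. -/
theorem overlap_positions_volume (A B e f x₁ x₂ y₁ y₂ : ℝ)
    (hx0 : 0 ≤ x₁) (hx : x₁ ≤ x₂) (hxA : x₂ ≤ A)
    (hy0 : 0 ≤ y₁) (hy : y₁ ≤ y₂) (hyB : y₂ ≤ B)
    (he0 : 0 ≤ e) (heA : e ≤ A) (hf0 : 0 ≤ f) (hfB : f ≤ B) :
    volume {u : ℝ × ℝ | u ∈ Set.Icc ((0 : ℝ), (0 : ℝ)) (A - e, B - f) ∧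
        (Set.Icc u (u + (e, f)) ∩ Set.Icc ((x₁ : ℝ), y₁) (x₂, y₂)).Nonempty} =
      ENNReal.ofReal
        ((min (A - e) x₂ - max 0 (x₁ - e)) * (min (B - f) y₂ - max 0 (y₁ - f))) ∧
    volume {u : ℝ × ℝ | u ∈ Set.Icc ((0 : ℝ), (0 : ℝ)) (A - e, B - f) ∧
        ¬(Set.Icc u (u + (e, f)) ∩ Set.Icc ((x₁ : ℝ), y₁) (x₂, y₂)).Nonempty} =
      volume (Set.Icc ((0 : ℝ), (0 : ℝ)) (A - e, B - f)) -
        ENNReal.ofReal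
          ((min (A - e) x₂ - max 0 (x₁ - e)) * (min (B - f) y₂ - max 0 (y₁ - f))) := by
  have key := overlap_positions_eq_Icc (A := A) (B := B) hx hy he0 hf0
  have hle : max 0 (x₁ - e) ≤ min (A - e) x₂ := by
    refine max_le (le_min ?_ ?_) (le_min ?_ ?_) <;> linarith
  have hvol := volume_Icc_real_prod (b := max 0 (y₁ - f)) (d := min (B - f) y₂) hle
  rw [← key] at hvol
  refine ⟨hvol, ?_⟩
  rw [← hvol, ← measure_sdiff (fun _ h => h.1)
    (key ▸ measurableSet_Icc.nullMeasurableSet) (hvol ▸ ENNReal.ofReal_ne_top)]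
  congr 1
  ext u
  simp only [Set.mem_ofPred_eq, Set.mem_sdiff]
  tauto
end

section
/- (Area of the lie-in-position region, used for P_LieIn, nondegenerate case.) Let A, B, e, f, x₁, x₂, y₁, y₂ ∈ ℝ with 0 ≤ x₁ ≤ x₂ ≤ A, 0 ≤ y₁ ≤ y₂ ≤ B, 0 ≤ e ≤ A, 0 ≤ f ≤ B, and suppose e > x₂ - x₁ and f > y₂ - y₁. Let I = Set.Icc (0, 0) (A - e, B - f). Then the Lebesgue measure of the set of positions u ∈ I for which the query rectangle Set.Icc u (u + (e, f)) fully contains the RMBR Set.Icc (x₁, y₁) (x₂, y₂) equals ENNReal.ofReal ((min (A - e) x₁ - max 0 (x₂ - e)) * (min (B - f) y₁ - max 0 (y₂ - f))). -/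
open MeasureTheory

/-- Area of the lie-in-position region (used for `P_LieIn`, nondegenerate case):
the Lebesgue measure of the set of admissible lower-left corner positions at
which the query rectangle fully contains the RMBR. -/
theorem lieIn_positions_volume (A B e f x₁ x₂ y₁ y₂ : ℝ)
    (hx0 : 0 ≤ x₁) (hx : x₁ ≤ x₂) (hxA : x₂ ≤ A)
    (hy0 : 0 ≤ y₁) (hy : y₁ ≤ y₂) (hyB : y₂ ≤ B)
    (he0 : 0 ≤ e) (heA : e ≤ A) (hf0 : 0 ≤ f) (hfB : f ≤ B)
    (he : e > x₂ - x₁) (hf : f > y₂ - y₁) :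
    volume {u : ℝ × ℝ | u ∈ Set.Icc ((0 : ℝ), (0 : ℝ)) (A - e, B - f) ∧
        Set.Icc ((x₁ : ℝ), y₁) (x₂, y₂) ⊆ Set.Icc u (u + (e, f))} =
      ENNReal.ofReal
        ((min (A - e) x₁ - max 0 (x₂ - e)) * (min (B - f) y₁ - max 0 (y₂ - f))) := by
  have hset : {u : ℝ × ℝ | u ∈ Set.Icc ((0 : ℝ), (0 : ℝ)) (A - e, B - f) ∧
      Set.Icc ((x₁ : ℝ), y₁) (x₂, y₂) ⊆ Set.Icc u (u + (e, f))} =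
      Set.Icc (max 0 (x₂ - e)) (min (A - e) x₁) ×ˢ
        Set.Icc (max 0 (y₂ - f)) (min (B - f) y₁) := by
    ext ⟨a, b⟩
    have hle : ((x₁ : ℝ), y₁) ≤ (x₂, y₂) := ⟨hx, hy⟩
    simp only [Set.mem_ofPred_eq, Set.Icc_subset_Icc_iff hle, Set.mem_Icc, Set.mem_prod,
      Prod.mk_le_mk, Prod.mk_add_mk, max_le_iff, le_min_iff, sub_le_iff_le_add]
    tauto
  have hwidth : 0 ≤ min (A - e) x₁ - max 0 (x₂ - e) :=
    sub_nonneg.2 (max_le (le_min (by linarith) hx0) (le_min (by linarith) (by linarith)))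
  rw [hset, Measure.volume_eq_prod, Measure.prod_prod, Real.volume_Icc, Real.volume_Icc,
    ENNReal.ofReal_mul hwidth]
end
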